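/- Let d ≥ 2, let A be an extremal d-dimensional (0,1)-matrix of order n with deficiency δ, and let Λ be an optimal hyperplane cover of A. Then: (1) if δ = 1 then every entry of Λ lies in {0, 1}; (2) it cannot hold that 1/2 < δ < 1, and if δ = 1/2 then every entry of Λ lies in {0, 1/2, 1}; (3) it cannot hold that 1/3 < δ < 1/2, and if δ = 1/3 then every entry of Λ lies in {0, 1/3, 2/3, 1}. -/

import Mathlib

open Finset

/-- A d-dimensional matrix of order n is a (0,1)-matrix if all entries are 0 or 1. -/
def IsZeroOne {d n : ℕ} (A : (Fin d → Fin n) → ℝ) : Prop :=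
  ∀ α, A α = 0 ∨ A α = 1

/-- A polyplex: nonnegative entries, each hyperplane sum at most 1. -/
def IsPolyplex {d n : ℕ} (K : (Fin d → Fin n) → ℝ) : Prop :=
  (∀ α, 0 ≤ K α) ∧
  ∀ (i : Fin d) (j : Fin n),
    (∑ α : Fin d → Fin n, if α i = j then K α else 0) ≤ 1

/-- The weight of a polyplex: the sum of all its entries. -/
def plexWeight {d n : ℕ} (K : (Fin d → Fin n) → ℝ) : ℝ := ∑ α, K α

/-- K is contained in A: supp(K) ⊆ supp(A). -/
def ContainedIn {d n : ℕ} (K A : (Fin d → Fin n) → ℝ) : Prop :=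
  ∀ α, K α ≠ 0 → A α ≠ 0

/-- The set of weights of polyplexes contained in A. -/
def polyplexWeights {d n : ℕ} (A : (Fin d → Fin n) → ℝ) : Set ℝ :=
  {W | ∃ K, IsPolyplex K ∧ ContainedIn K A ∧ plexWeight K = W}

/-- A contains a polydiagonal: a polyplex of weight n. -/
def HasPolydiagonal {d n : ℕ} (A : (Fin d → Fin n) → ℝ) : Prop :=
  ∃ K, IsPolyplex K ∧ ContainedIn K A ∧ plexWeight K = (n : ℝ)

/-- A is extremal: no polydiagonal, but changing any zero entry to 1 creates one. -/
def IsExtremal {d n : ℕ} (A : (Fin d → Fin n) → ℝ) : Prop :=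
  ¬ HasPolydiagonal A ∧
  ∀ α, A α = 0 → HasPolydiagonal (Function.update A α (1 : ℝ))

/-- A hyperplane cover of A: nonnegative weights on hyperplanes covering supp(A). -/
def IsCover {d n : ℕ} (A : (Fin d → Fin n) → ℝ) (Λ : Fin d → Fin n → ℝ) : Prop :=
  (∀ i j, 0 ≤ Λ i j) ∧ ∀ α, A α ≠ 0 → 1 ≤ ∑ i, Λ i (α i)

/-- The weight of a hyperplane cover. -/
def coverWeight {d n : ℕ} (Λ : Fin d → Fin n → ℝ) : ℝ := ∑ i, ∑ j, Λ i j

/-- The set of weights of hyperplane covers of A. -/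
def coverWeights {d n : ℕ} (A : (Fin d → Fin n) → ℝ) : Set ℝ :=
  {W | ∃ Λ : Fin d → Fin n → ℝ, IsCover A Λ ∧ coverWeight Λ = W}

/-- Λ is an optimal hyperplane cover of A. -/
def IsOptimalCover {d n : ℕ} (A : (Fin d → Fin n) → ℝ) (Λ : Fin d → Fin n → ℝ) : Prop :=
  IsCover A Λ ∧ ∀ Λ' : Fin d → Fin n → ℝ, IsCover A Λ' → coverWeight Λ ≤ coverWeight Λ'

/-- K is an optimal polyplex contained in A. -/
def IsOptimalPolyplex {d n : ℕ} (A K : (Fin d → Fin n) → ℝ) : Prop :=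
  IsPolyplex K ∧ ContainedIn K A ∧
  ∀ K' : (Fin d → Fin n) → ℝ, IsPolyplex K' → ContainedIn K' A → plexWeight K' ≤ plexWeight K

/-- A(Λ): the (0,1)-matrix of indices covered with weight at least 1 by Λ. -/
noncomputable def matOf {d n : ℕ} (Λ : Fin d → Fin n → ℝ) : (Fin d → Fin n) → ℝ :=
  fun α => if 1 ≤ ∑ i, Λ i (α i) then (1 : ℝ) else 0

/-- A has deficiency δ: the maximum weight of a polyplex contained in A is n − δ. -/
def HasDeficiency {d n : ℕ} (A : (Fin d → Fin n) → ℝ) (δ : ℝ) : Prop :=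
  IsGreatest (polyplexWeights A) ((n : ℝ) - δ)

/-- The total weight of a matrix `K` on the hyperplane in direction `i` at height `j`. -/
noncomputable def hyperplaneSum {d n : ℕ} (K : (Fin d → Fin n) → ℝ) (i : Fin d) (j : Fin n) : ℝ :=
  ∑ α : Fin d → Fin n, if α i = j then K α else 0

theorem sum_mul_hyperplaneSum {d n : ℕ} (K : (Fin d → Fin n) → ℝ) (f : Fin d → Fin n → ℝ) :
    ∑ i, ∑ j, f i j * hyperplaneSum K i j = ∑ α, K α * ∑ i, f i (α i) := by
  simp only [hyperplaneSum, Finset.mul_sum]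
  rw [Finset.sum_comm (s := (univ : Finset (Fin d → Fin n)))]
  refine Finset.sum_congr rfl fun i _ => ?_
  rw [Finset.sum_comm]
  refine Finset.sum_congr rfl fun α _ => ?_
  simp [mul_comm]

theorem IsPolyplex.sum_mul_le_coverWeight {d n : ℕ} {K : (Fin d → Fin n) → ℝ} (hK : IsPolyplex K)
    {Λ : Fin d → Fin n → ℝ} (hΛ : ∀ i j, 0 ≤ Λ i j) :
    ∑ α, K α * ∑ i, Λ i (α i) ≤ coverWeight Λ := by
  rw [← sum_mul_hyperplaneSum]
  exact Finset.sum_le_sum fun i _ => Finset.sum_le_sum fun j _ =>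
    mul_le_of_le_one_right (hΛ i j) (hK.2 i j)

theorem IsCover.le_mul_sum {d n : ℕ} {A K : (Fin d → Fin n) → ℝ} {Λ : Fin d → Fin n → ℝ}
    (hΛ : IsCover A Λ) (hK : ∀ α, 0 ≤ K α) (hKA : ContainedIn K A) (α : Fin d → Fin n) :
    K α ≤ K α * ∑ i, Λ i (α i) := by
  by_cases h : K α = 0
  · simp [h]
  · exact le_mul_of_one_le_right (hK α) (hΛ.2 α (hKA α h))

/-- Weak duality between polyplexes and hyperplane covers. -/
theorem IsCover.plexWeight_le {d n : ℕ} {A K : (Fin d → Fin n) → ℝ} {Λ : Fin d → Fin n → ℝ}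
    (hΛ : IsCover A Λ) (hK : IsPolyplex K) (hKA : ContainedIn K A) :
    plexWeight K ≤ coverWeight Λ :=
  (Finset.sum_le_sum fun α _ => hΛ.le_mul_sum hK.1 hKA α).trans (hK.sum_mul_le_coverWeight hΛ.1)

/-- Complementary slackness. -/
theorem complementary_slackness {d n : ℕ} {A K : (Fin d → Fin n) → ℝ} {Λ : Fin d → Fin n → ℝ}
    (hΛ : IsCover A Λ) (hK : IsPolyplex K) (hKA : ContainedIn K A)
    (h : plexWeight K = coverWeight Λ) :
    (∀ α, K α ≠ 0 → ∑ i, Λ i (α i) = 1) ∧ ∀ i j, Λ i j ≠ 0 → hyperplaneSum K i j = 1 := by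
  have h1 := hK.sum_mul_le_coverWeight hΛ.1
  have h2 : plexWeight K ≤ ∑ α, K α * ∑ i, Λ i (α i) :=
    Finset.sum_le_sum fun α _ => hΛ.le_mul_sum hK.1 hKA α
  constructor
  · intro α hα
    have e : ∑ α, K α = ∑ α, K α * ∑ i, Λ i (α i) := le_antisymm h2 (h1.trans h.ge)
    have := (Finset.sum_eq_sum_iff_of_le fun α _ => hΛ.le_mul_sum hK.1 hKA α).1 e α (mem_univ α)
    exact mul_left_cancel₀ hα (by rw [← this, mul_one])
  · intro i j hij
    have e : ∑ i, ∑ j, Λ i j * hyperplaneSum K i j = ∑ i, ∑ j, Λ i j := by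
      rw [sum_mul_hyperplaneSum]
      exact le_antisymm h1 (h.ge.trans h2)
    have hle : ∀ i j, Λ i j * hyperplaneSum K i j ≤ Λ i j := fun i j =>
      mul_le_of_le_one_right (hΛ.1 i j) (hK.2 i j)
    have e1 := (Finset.sum_eq_sum_iff_of_le fun i _ =>
      Finset.sum_le_sum fun j _ => hle i j).1 e i (mem_univ i)
    have e2 := (Finset.sum_eq_sum_iff_of_le fun j _ => hle i j).1 e1 j (mem_univ j)
    exact mul_left_cancel₀ hij (by rw [e2, mul_one])

theorem hyperplaneSum_smul {d n : ℕ} (c : ℝ) (K : (Fin d → Fin n) → ℝ) (i : Fin d) (j : Fin n) :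
    hyperplaneSum (fun α => c * K α) i j = c * hyperplaneSum K i j := by
  simp only [hyperplaneSum, Finset.mul_sum]
  exact Finset.sum_congr rfl fun α _ => by split_ifs <;> simp

theorem hyperplaneSum_single {d n : ℕ} (α : Fin d → Fin n) (i : Fin d) (j : Fin n) :
    hyperplaneSum (Pi.single α 1) i j = if α i = j then 1 else 0 := by
  unfold hyperplaneSum
  rw [Finset.sum_eq_single α]
  · simp
  · intro β _ hβ
    simp [hβ]
  · simp

theorem isPolyplex_single {d n : ℕ} (α : Fin d → Fin n) : IsPolyplex (Pi.single α (1 : ℝ)) := by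
  refine ⟨fun β => ?_, fun i j => ?_⟩
  · by_cases h : β = α
    · subst h; simp
    · simp [h]
  · refine (hyperplaneSum_single α i j).le.trans ?_
    split_ifs <;> simp

/-- Strong duality between polyplexes and hyperplane covers. -/
theorem exists_cover_le {d n : ℕ} (hd : 0 < d) (hn : 0 < n) {A : (Fin d → Fin n) → ℝ} {W : ℝ}
    (hW : IsGreatest (polyplexWeights A) W) : ∃ Λ, IsCover A Λ ∧ coverWeight Λ ≤ W := by
  by_cases hA : ∀ α, A α = 0
  · refine ⟨fun _ _ => 0, ⟨fun _ _ => le_rfl, fun α h => (h (hA α)).elim⟩, ?_⟩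
    have : (0 : ℝ) ∈ polyplexWeights A :=
      ⟨fun _ => 0, ⟨fun _ => le_rfl, fun i j => by simp⟩, fun α h => (h rfl).elim,
        by simp [plexWeight]⟩
    simpa [coverWeight] using hW.2 this
  push Not at hA
  obtain ⟨α₀, hα₀⟩ := hA
  have single_contained : ∀ α, A α ≠ 0 → ContainedIn (Pi.single α (1 : ℝ)) A := by
    intro α hα β hβ
    by_cases h : β = α
    · rwa [h]
    · simp [h] at hβ
  have hW0 : 0 < W := by
    have : (1 : ℝ) ≤ W := hW.2 ⟨Pi.single α₀ 1, isPolyplex_single α₀, single_contained α₀ hα₀,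
      by simp [plexWeight]⟩
    linarith
  let s : Set (Fin d → Fin n → ℝ) := {y | ∀ i j, y i j < 1 / W}
  let t : Set (Fin d → Fin n → ℝ) := {y | ∃ K : (Fin d → Fin n) → ℝ, (∀ α, 0 ≤ K α) ∧
    ContainedIn K A ∧ plexWeight K = 1 ∧ y = hyperplaneSum K}
  have hs : Convex ℝ s := by
    intro x hx y hy a b ha hb hab i j
    exact convex_Iio (1 / W) (hx i j) (hy i j) ha hb hab
  have hso : IsOpen s := by
    simp only [s, Set.ofPred_forall]
    refine isOpen_iInter_of_finite fun i => isOpen_iInter_of_finite fun j => ?_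
    exact isOpen_lt (by fun_prop) continuous_const
  have ht : Convex ℝ t := by
    rintro x ⟨K, hK, hKA, hKw, rfl⟩ y ⟨L, hL, hLA, hLw, rfl⟩ a b ha hb hab
    refine ⟨fun α => a * K α + b * L α, fun α => ?_, fun α h => ?_, ?_, ?_⟩
    · have := hK α
      have := hL α
      positivity
    · by_cases h1 : K α = 0
      · by_cases h2 : L α = 0
        · simp [h1, h2] at h
        · exact hLA α h2
      · exact hKA α h1
    · unfold plexWeight at *
      rw [Finset.sum_add_distrib, ← Finset.mul_sum, ← Finset.mul_sum, hKw, hLw]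
      linarith
    · ext i j
      simp only [hyperplaneSum, Pi.add_apply, Pi.smul_apply, smul_eq_mul, Finset.mul_sum,
        ← Finset.sum_add_distrib]
      exact Finset.sum_congr rfl fun α _ => by split_ifs <;> simp
  have hst : Disjoint s t := by
    rw [Set.disjoint_left]
    rintro y hy ⟨K, hK, hKA, hKw, rfl⟩
    have : Nonempty (Fin d) := ⟨⟨0, hd⟩⟩
    have : Nonempty (Fin n) := ⟨⟨0, hn⟩⟩
    obtain ⟨p, hp⟩ := Finite.exists_max fun p : Fin d × Fin n => hyperplaneSum K p.1 p.2
    set M := max (hyperplaneSum K p.1 p.2) (1 / (2 * W)) with hM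
    have hM0 : 0 < M := lt_max_of_lt_right (by positivity)
    have hMW : M < 1 / W := max_lt (hy p.1 p.2) (by gcongr; linarith)
    have hle : M⁻¹ ≤ W := by
      refine hW.2 ⟨fun α => M⁻¹ * K α, ⟨fun α => mul_nonneg (by positivity) (hK α),
        fun i j => ?_⟩, fun α h => hKA α (right_ne_zero_of_mul h), ?_⟩
      · refine (hyperplaneSum_smul M⁻¹ K i j).le.trans ?_
        rw [inv_mul_le_iff₀ hM0, mul_one]
        exact (hp (i, j)).trans (le_max_left _ _)
      · unfold plexWeight at *
        rw [← Finset.mul_sum, hKw, mul_one]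
    rw [lt_div_iff₀ hW0] at hMW
    rw [inv_le_iff_one_le_mul₀ hM0] at hle
    linarith
  obtain ⟨f, u, hfs, hft⟩ := geometric_hahn_banach_open hs hso ht hst
  set c : Fin d → Fin n → ℝ := fun i j => f (Pi.single i (Pi.single j 1)) with hc
  have hf : ∀ y, f y = ∑ i, ∑ j, y i j * c i j := by
    intro y
    have : y = ∑ i, ∑ j, y i j • Pi.single i (Pi.single j (1 : ℝ)) := by
      ext a b
      simp only [Finset.sum_apply, Pi.smul_apply, smul_eq_mul]
      rw [Finset.sum_eq_single a, Finset.sum_eq_single b]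
      · simp
      · intro j _ hj
        simp [hj.symm]
      · simp
      · intro i _ hi
        refine Finset.sum_eq_zero fun j _ => ?_
        rw [Pi.single_eq_of_ne hi.symm]
        simp
      · simp
    conv_lhs => rw [this]
    simp [map_sum, hc]
  have hu : 0 < u := by
    have := hfs 0 (fun i j => by simpa using hW0)
    simpa using this
  have hc0 : ∀ i j, 0 ≤ c i j := by
    intro i j
    by_contra! h
    have h1 := hfs ((u / c i j) • Pi.single i (Pi.single j 1)) (fun a b => by
      have h2 : u / c i j ≤ 0 := (div_neg_of_pos_of_neg hu h).le
      have h3 : (0 : ℝ) ≤ (Pi.single i (Pi.single j 1) : Fin d → Fin n → ℝ) a b := by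
        by_cases ha : a = i
        · subst ha
          by_cases hb : b = j
          · subst hb; simp
          · simp [hb]
        · simp [ha]
      have h4 : 0 < 1 / W := by positivity
      simp only [Pi.smul_apply, smul_eq_mul]
      nlinarith [mul_nonneg (neg_nonneg.2 h2) h3])
    rw [map_smul, smul_eq_mul, show f (Pi.single i (Pi.single j 1)) = c i j from rfl,
      div_mul_cancel₀ _ h.ne] at h1
    exact lt_irrefl _ h1
  refine ⟨fun i j => c i j / u, ⟨fun i j => div_nonneg (hc0 i j) hu.le, fun α hα => ?_⟩, ?_⟩
  · have := hft (hyperplaneSum (Pi.single α 1))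
      ⟨_, (isPolyplex_single α).1, single_contained α hα, by simp [plexWeight], rfl⟩
    rw [hf] at this
    simp only [hyperplaneSum_single, ite_mul, one_mul, zero_mul, Finset.sum_ite_eq,
      Finset.mem_univ, if_true] at this
    rw [← Finset.sum_div, one_le_div hu]
    exact this
  · have e : coverWeight (fun i j => c i j / u) = (∑ i, ∑ j, c i j) / u := by
      simp only [coverWeight, Finset.sum_div]
    rw [e, div_le_iff₀ hu]
    by_contra! h
    have hpos : 0 < ∑ i, ∑ j, c i j := lt_trans (by positivity) h
    have := hfs (fun _ _ => u / ∑ i, ∑ j, c i j) (fun i j => by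
      rw [div_lt_div_iff₀ hpos hW0]
      linarith)
    rw [hf] at this
    simp only [← Finset.mul_sum] at this
    rw [div_mul_cancel₀ _ hpos.ne'] at this
    exact lt_irrefl _ this

theorem IsOptimalCover.coverWeight_eq {d n : ℕ} (hd : 0 < d) (hn : 0 < n)
    {A : (Fin d → Fin n) → ℝ} {W : ℝ} (hW : IsGreatest (polyplexWeights A) W)
    {Λ : Fin d → Fin n → ℝ} (hΛ : IsOptimalCover A Λ) : coverWeight Λ = W := by
  obtain ⟨M, hM, hMW⟩ := exists_cover_le hd hn hW
  obtain ⟨K, hK, hKA, hKW⟩ := hW.1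
  exact le_antisymm ((hΛ.2 M hM).trans hMW) (hKW ▸ hΛ.1.plexWeight_le hK hKA)

theorem IsOptimalCover.eq_of_le {d n : ℕ} {A : (Fin d → Fin n) → ℝ} {Λ M : Fin d → Fin n → ℝ}
    (hΛ : IsOptimalCover A Λ) (hM : IsCover A M) (hle : ∀ i j, M i j ≤ Λ i j) (i : Fin d)
    (j : Fin n) : M i j = Λ i j := by
  have e : ∑ i, ∑ j, M i j = ∑ i, ∑ j, Λ i j :=
    le_antisymm (Finset.sum_le_sum fun i _ => Finset.sum_le_sum fun j _ => hle i j) (hΛ.2 M hM)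
  have e1 := (Finset.sum_eq_sum_iff_of_le fun i _ =>
    Finset.sum_le_sum fun j _ => hle i j).1 e i (mem_univ i)
  exact (Finset.sum_eq_sum_iff_of_le fun j _ => hle i j).1 e1 j (mem_univ j)

theorem IsOptimalCover.le_one {d n : ℕ} {A : (Fin d → Fin n) → ℝ} {Λ : Fin d → Fin n → ℝ}
    (hΛ : IsOptimalCover A Λ) (i : Fin d) (j : Fin n) : Λ i j ≤ 1 := by
  have hM : IsCover A fun i j => min (Λ i j) 1 := by
    refine ⟨fun i j => le_min (hΛ.1.1 i j) zero_le_one, fun α hα => ?_⟩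
    by_cases h : ∃ i, 1 ≤ Λ i (α i)
    · obtain ⟨i, hi⟩ := h
      calc (1 : ℝ) = min (Λ i (α i)) 1 := (min_eq_right hi).symm
        _ ≤ _ := Finset.single_le_sum (f := fun i => min (Λ i (α i)) 1)
          (fun i _ => le_min (hΛ.1.1 _ _) zero_le_one) (mem_univ i)
    · push Not at h
      rw [Finset.sum_congr rfl fun i _ => min_eq_left (h i).le]
      exact hΛ.1.2 α hα
  rw [← hΛ.eq_of_le hM (fun i j => min_le_left _ _) i j]
  exact min_le_right _ _

/-- An optimal cover of weight less than `n` vanishes on some hyperplane of each direction. -/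
theorem IsOptimalCover.exists_eq_zero {d n : ℕ} (hn : 0 < n) {A : (Fin d → Fin n) → ℝ}
    {Λ : Fin d → Fin n → ℝ} (hΛ : IsOptimalCover A Λ) (hw : coverWeight Λ < n) (i : Fin d) :
    ∃ j, Λ i j = 0 := by
  have : Nonempty (Fin n) := ⟨⟨0, hn⟩⟩
  choose z hz using fun i => Finite.exists_min (Λ i)
  refine ⟨z i, ?_⟩
  set μ := ∑ i, Λ i (z i) with hμ
  have hsum : ∑ i, ∑ _j : Fin n, Λ i (z i) = n * μ := by
    simp [hμ, Finset.mul_sum]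
  have hnμ : n * μ ≤ coverWeight Λ := by
    rw [← hsum]
    exact Finset.sum_le_sum fun i _ => Finset.sum_le_sum fun j _ => hz i j
  have hn' : (0 : ℝ) < n := by exact_mod_cast hn
  have hμ1 : μ < 1 := by nlinarith
  have hM : IsCover A fun i j => (Λ i j - Λ i (z i)) / (1 - μ) := by
    refine ⟨fun i j => div_nonneg (sub_nonneg.2 (hz i j)) (by linarith), fun α hα => ?_⟩
    rw [← Finset.sum_div, one_le_div (by linarith), Finset.sum_sub_distrib]
    linarith [hΛ.1.2 α hα]
  have h := hΛ.2 _ hM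
  have e : coverWeight (fun i j => (Λ i j - Λ i (z i)) / (1 - μ)) =
      (coverWeight Λ - n * μ) / (1 - μ) := by
    rw [← hsum]
    simp only [coverWeight, ← Finset.sum_div, Finset.sum_sub_distrib]
  rw [e, le_div_iff₀ (by linarith)] at h
  have hμ0 : μ ≤ 0 := by nlinarith
  have : Λ i (z i) ≤ μ := Finset.single_le_sum (f := fun i => Λ i (z i))
    (fun i _ => hΛ.1.1 _ _) (mem_univ i)
  exact le_antisymm (this.trans hμ0) (hΛ.1.1 _ _)

theorem IsExtremal.sum_le_or {d n : ℕ} (hd : 0 < d) {A : (Fin d → Fin n) → ℝ} (hE : IsExtremal A)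
    {Λ : Fin d → Fin n → ℝ} (hΛ : IsCover A Λ) {δ : ℝ} (hδ : 0 < δ)
    (hw : coverWeight Λ = n - δ) (α : Fin d → Fin n) :
    ∑ i, Λ i (α i) ≤ 1 - δ ∨ 1 ≤ ∑ i, Λ i (α i) := by
  by_cases hα : A α = 0
  swap
  · exact Or.inr (hΛ.2 α hα)
  left
  obtain ⟨K, hK, hKA, hKn⟩ := hE.2 α hα
  have h1 := hK.sum_mul_le_coverWeight hΛ.1
  have h2 : K α * (∑ i, Λ i (α i) - 1) ≤ ∑ β, (K β * ∑ i, Λ i (β i) - K β) := by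
    rw [← Finset.add_sum_erase univ _ (mem_univ α)]
    have : 0 ≤ ∑ β ∈ univ.erase α, (K β * ∑ i, Λ i (β i) - K β) := by
      refine Finset.sum_nonneg fun β hβ => ?_
      have hne := Finset.ne_of_mem_erase hβ
      by_cases h0 : K β = 0
      · simp [h0]
      · have hβA := hKA β h0
        rw [Function.update_of_ne hne] at hβA
        have := hΛ.2 β hβA
        nlinarith [hK.1 β]
    linarith
  rw [Finset.sum_sub_distrib] at h2
  change ∑ β, K β = n at hKn
  have hK1 : K α ≤ 1 := by
    refine le_trans ?_ (hK.2 ⟨0, hd⟩ (α ⟨0, hd⟩))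
    refine le_trans (by simp) (Finset.single_le_sum (f := fun β =>
      if β ⟨0, hd⟩ = α ⟨0, hd⟩ then K β else 0) (fun β _ => ?_) (mem_univ α))
    split_ifs
    exacts [hK.1 β, le_rfl]
  have h3 : δ ≤ K α * (1 - ∑ i, Λ i (α i)) := by linarith
  have h4 : 0 < 1 - ∑ i, Λ i (α i) := pos_of_mul_pos_right (hδ.trans_le h3) (hK.1 α)
  nlinarith

/-- A partial sum of an optimal cover of an extremal matrix avoids the gap `(1 - δ, 1)`. -/
theorem IsExtremal.partial_sum_le_or {d n : ℕ} (hd : 0 < d) (hn : 0 < n)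
    {A : (Fin d → Fin n) → ℝ} (hE : IsExtremal A)
    {Λ : Fin d → Fin n → ℝ} (hΛ : IsOptimalCover A Λ) {δ : ℝ} (hδ : 0 < δ)
    (hw : coverWeight Λ = n - δ) (S : Finset (Fin d)) (α : Fin d → Fin n) :
    ∑ i ∈ S, Λ i (α i) ≤ 1 - δ ∨ 1 ≤ ∑ i ∈ S, Λ i (α i) := by
  choose z hz using hΛ.exists_eq_zero hn (by linarith)
  have e : ∑ i, Λ i (if i ∈ S then α i else z i) = ∑ i ∈ S, Λ i (α i) := by
    rw [← Finset.sum_subset (Finset.subset_univ S)]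
    · exact Finset.sum_congr rfl fun i hi => by rw [if_pos hi]
    · intro i _ hi
      rw [if_neg hi, hz]
  rw [← e]
  exact hE.sum_le_or hd hΛ.1 hδ hw _

/-- Nonzero entries of an optimal cover are at least the deficiency. -/
theorem IsExtremal.eq_zero_or_le {d n : ℕ} (hd : 0 < d) (hn : 0 < n)
    {A : (Fin d → Fin n) → ℝ} (hE : IsExtremal A)
    {Λ : Fin d → Fin n → ℝ} (hΛ : IsOptimalCover A Λ) {δ : ℝ} (hδ : 0 < δ)
    (hw : coverWeight Λ = n - δ) (i : Fin d) (j : Fin n) : Λ i j = 0 ∨ δ ≤ Λ i j := by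
  have hM : IsCover A fun i j => if Λ i j < δ then 0 else Λ i j := by
    refine ⟨fun i j => ?_, fun α hα => ?_⟩
    · dsimp only
      split_ifs
      exacts [le_rfl, hΛ.1.1 i j]
    have key : ∀ T : Finset (Fin d), (∀ i ∈ T, Λ i (α i) < δ) → 1 ≤ ∑ i ∈ Tᶜ, Λ i (α i) := by
      intro T
      induction T using Finset.induction_on with
      | empty => intro _; simpa using hΛ.1.2 α hα
      | insert a T ha ih =>
        intro hT
        have h1 := ih fun i hi => hT i (mem_insert_of_mem hi)
        have h2 := hT a (mem_insert_self a T)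
        rw [Finset.compl_insert]
        rw [← Finset.add_sum_erase Tᶜ _ (mem_compl.2 ha)] at h1
        rcases hE.partial_sum_le_or hd hn hΛ hδ hw (Tᶜ.erase a) α with h | h
        · linarith
        · exact h
    have := key (univ.filter fun i => Λ i (α i) < δ) (by simp)
    rw [Finset.compl_filter, Finset.sum_filter] at this
    simpa only [ite_not] using this
  have h := hΛ.eq_of_le hM (fun i j => by
    split_ifs
    exacts [hΛ.1.1 i j, le_rfl]) i j
  by_cases hlt : Λ i j < δ
  · left
    simpa [hlt] using h.symm
  · right
    exact not_lt.1 hlt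

/-- If every entry is `0`, `1` or close to `1/2`, the weight is a half-integer. -/
theorem exists_two_mul_coverWeight_eq {d n : ℕ} {A K : (Fin d → Fin n) → ℝ}
    {Λ : Fin d → Fin n → ℝ}
    (hΛ : IsCover A Λ) (hK : IsPolyplex K) (hKA : ContainedIn K A)
    (h : plexWeight K = coverWeight Λ)
    (hmid : ∀ i j, Λ i j = 0 ∨ Λ i j = 1 ∨ 1 / 3 < Λ i j ∧ Λ i j < 2 / 3) :
    ∃ m : ℤ, 2 * coverWeight Λ = m := by
  obtain ⟨hs1, hs2⟩ := complementary_slackness hΛ hK hKA h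
  obtain ⟨k, hk⟩ : ∃ k : Fin d → Fin n → ℤ, ∀ i j, (Λ i j = 0 ∧ k i j = 0) ∨
      (Λ i j ≠ 0 ∧ 3 / 2 * Λ i j < k i j ∧ (k i j : ℝ) < 3 * Λ i j) := by
    have : ∀ i j, ∃ k : ℤ, (Λ i j = 0 ∧ k = 0) ∨
        (Λ i j ≠ 0 ∧ 3 / 2 * Λ i j < k ∧ (k : ℝ) < 3 * Λ i j) := by
      intro i j
      rcases hmid i j with h0 | h1 | ⟨h1, h2⟩
      · exact ⟨0, Or.inl ⟨h0, rfl⟩⟩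
      · exact ⟨2, Or.inr (by norm_num [h1])⟩
      · refine ⟨1, Or.inr ⟨by linarith, ?_, ?_⟩⟩ <;> push_cast <;> linarith
    choose k hk using this
    exact ⟨k, hk⟩
  have hk2 : ∀ α, K α ≠ 0 → ∑ i, k i (α i) = 2 := by
    intro α hα
    have hsum := hs1 α hα
    obtain ⟨i, hi⟩ : ∃ i, Λ i (α i) ≠ 0 := by
      by_contra! h0
      simp [h0] at hsum
    have hlo : ∑ i, 3 / 2 * Λ i (α i) < ∑ i, (k i (α i) : ℝ) := by
      refine Finset.sum_lt_sum (fun i _ => ?_) ⟨i, mem_univ i, ?_⟩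
      · rcases hk i (α i) with ⟨h1, h2⟩ | ⟨-, h1, -⟩
        · simp [h1, h2]
        · exact h1.le
      · rcases hk i (α i) with ⟨h1, -⟩ | ⟨-, h1, -⟩
        exacts [(hi h1).elim, h1]
    have hhi : ∑ i, (k i (α i) : ℝ) < ∑ i, 3 * Λ i (α i) := by
      refine Finset.sum_lt_sum (fun i _ => ?_) ⟨i, mem_univ i, ?_⟩
      · rcases hk i (α i) with ⟨h1, h2⟩ | ⟨-, -, h1⟩
        · simp [h1, h2]
        · exact h1.le
      · rcases hk i (α i) with ⟨h1, -⟩ | ⟨-, -, h1⟩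
        exacts [(hi h1).elim, h1]
    rw [← Finset.mul_sum, hsum] at hlo hhi
    have h1 : (1 : ℝ) < ((∑ i, k i (α i) : ℤ) : ℝ) := by push_cast; linarith
    have h3 : ((∑ i, k i (α i) : ℤ) : ℝ) < 3 := by push_cast; linarith
    have h1' : (1 : ℤ) < ∑ i, k i (α i) := by exact_mod_cast h1
    have h3' : ∑ i, k i (α i) < (3 : ℤ) := by exact_mod_cast h3
    omega
  refine ⟨∑ i, ∑ j, k i j, ?_⟩
  have e := sum_mul_hyperplaneSum K fun i j => (k i j : ℝ)
  have e1 : ∑ i, ∑ j, (k i j : ℝ) * hyperplaneSum K i j = ∑ i, ∑ j, (k i j : ℝ) := by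
    refine Finset.sum_congr rfl fun i _ => Finset.sum_congr rfl fun j _ => ?_
    rcases hk i j with ⟨-, h1⟩ | ⟨h1, -⟩
    · simp [h1]
    · rw [hs2 i j h1, mul_one]
  have e2 : ∑ α, K α * ∑ i, (k i (α i) : ℝ) = ∑ α, 2 * K α := by
    refine Finset.sum_congr rfl fun α _ => ?_
    by_cases h0 : K α = 0
    · simp [h0]
    · have : (∑ i, (k i (α i) : ℝ)) = 2 := by exact_mod_cast hk2 α h0
      rw [this, mul_comm]
  rw [e1, e2, ← Finset.mul_sum] at e
  push_cast
  rw [e, ← h, plexWeight]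

theorem exists_pos_of_hyperplaneSum_eq_one {d n : ℕ} {K : (Fin d → Fin n) → ℝ} {i : Fin d}
    {j : Fin n} (h : hyperplaneSum K i j = 1) : ∃ α, α i = j ∧ K α ≠ 0 := by
  by_contra! h0
  have : hyperplaneSum K i j = 0 := Finset.sum_eq_zero fun α _ => by
    split_ifs with hα
    exacts [h0 α hα, rfl]
  linarith

/-- extremal matrices of big deficiencies. -/
theorem stmt_11 (d n : ℕ) (hd : 2 ≤ d) (A : (Fin d → Fin n) → ℝ)
    (hA : IsZeroOne A) (hE : IsExtremal A)
    (δ : ℝ) (hδ : HasDeficiency A δ)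
    (Λ : Fin d → Fin n → ℝ) (hΛ : IsOptimalCover A Λ) :
    (δ = 1 → ∀ i j, Λ i j = 0 ∨ Λ i j = 1) ∧
    (¬ (1 / 2 < δ ∧ δ < 1)) ∧
    (δ = 1 / 2 → ∀ i j, Λ i j = 0 ∨ Λ i j = 1 / 2 ∨ Λ i j = 1) ∧
    (¬ (1 / 3 < δ ∧ δ < 1 / 2)) ∧
    (δ = 1 / 3 → ∀ i j, Λ i j = 0 ∨ Λ i j = 1 / 3 ∨ Λ i j = 2 / 3 ∨ Λ i j = 1) := by
  have hd0 : 0 < d := by omega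
  have hn : 0 < n := by
    rcases Nat.eq_zero_or_pos n with rfl | h
    · exact (hE.1 ⟨fun _ => 0, ⟨fun _ => le_rfl, fun i j => by simp⟩, fun α h => (h rfl).elim,
        by simp [plexWeight]⟩).elim
    · exact h
  have hw := hΛ.coverWeight_eq hd0 hn hδ
  obtain ⟨K, hK, hKA, hKW⟩ := hδ.1
  have hKΛ : plexWeight K = coverWeight Λ := hKW.trans hw.symm
  obtain ⟨hs1, hs2⟩ := complementary_slackness hΛ.1 hK hKA hKΛ
  have entry_cases : 0 < δ → ∀ i j, Λ i j = 0 ∨ Λ i j = 1 ∨ δ ≤ Λ i j ∧ Λ i j ≤ 1 - δ := by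
    intro hδ0 i j
    rcases hE.eq_zero_or_le hd0 hn hΛ hδ0 hw i j with h0 | h1
    · exact Or.inl h0
    · have := hE.partial_sum_le_or hd0 hn hΛ hδ0 hw {i} (fun _ => j)
      rw [Finset.sum_singleton] at this
      rcases this with h2 | h2
      · exact Or.inr (Or.inr ⟨h1, h2⟩)
      · exact Or.inr (Or.inl (le_antisymm (hΛ.le_one i j) h2))
  have half : (∀ i j, Λ i j = 0 ∨ Λ i j = 1 ∨ 1 / 3 < Λ i j ∧ Λ i j < 2 / 3) →
      ∃ m : ℤ, 2 * δ = m := by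
    intro h
    obtain ⟨m, hm⟩ := exists_two_mul_coverWeight_eq hΛ.1 hK hKA hKΛ h
    exact ⟨2 * n - m, by push_cast; linarith⟩
  refine ⟨fun hδ1 i j => ?_, fun ⟨h1, h2⟩ => ?_, fun hδ2 i j => ?_, fun ⟨h1, h2⟩ => ?_,
    fun hδ3 i j => ?_⟩
  · rcases entry_cases (by linarith) i j with h | h | ⟨h, h'⟩
    · exact Or.inl h
    · exact Or.inr h
    · linarith
  · obtain ⟨m, hm⟩ := half fun i j => by
      rcases entry_cases (by linarith) i j with h | h | ⟨h, h'⟩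
      · exact Or.inl h
      · exact Or.inr (Or.inl h)
      · linarith
    have h3 : (1 : ℝ) < m := by linarith
    have h4 : (m : ℝ) < 2 := by linarith
    norm_cast at h3 h4
    omega
  · rcases entry_cases (by linarith) i j with h | h | ⟨h, h'⟩
    · exact Or.inl h
    · exact Or.inr (Or.inr h)
    · exact Or.inr (Or.inl (by linarith))
  · obtain ⟨m, hm⟩ := half fun i j => by
      rcases entry_cases (by linarith) i j with h | h | ⟨h, h'⟩
      · exact Or.inl h
      · exact Or.inr (Or.inl h)
      · exact Or.inr (Or.inr ⟨by linarith, by linarith⟩)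
    have h3 : (0 : ℝ) < m := by linarith
    have h4 : (m : ℝ) < 1 := by linarith
    norm_cast at h3 h4
    omega
  · subst hδ3
    have hδ0 : (0 : ℝ) < 1 / 3 := by norm_num
    have third : ∀ i j, Λ i j = 0 ∨ 1 / 3 ≤ Λ i j := hE.eq_zero_or_le hd0 hn hΛ hδ0 hw
    by_contra! hne
    obtain ⟨hne0, hne1, hne2, hne3⟩ := hne
    have hmid : 1 / 3 < Λ i j ∧ Λ i j < 2 / 3 := by
      rcases entry_cases hδ0 i j with h | h | ⟨h, h'⟩
      · exact (hne0 h).elim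
      · exact (hne3 h).elim
      · exact ⟨lt_of_le_of_ne h (Ne.symm hne1), lt_of_le_of_ne (by linarith) hne2⟩
    -- a cell on which the cover is tight has a single remaining positive entry
    have partner : ∀ i j, 1 / 3 < Λ i j → Λ i j < 1 →
        ∃ i' j', i' ≠ i ∧ Λ i' j' = 1 - Λ i j := by
      intro i j h1 h2
      obtain ⟨α, rfl, hα⟩ := exists_pos_of_hyperplaneSum_eq_one (hs2 i j (by linarith))
      have hsum := hs1 α hα
      rw [← Finset.add_sum_erase univ _ (mem_univ i)] at hsum
      obtain ⟨i', hi', hne'⟩ : ∃ i' ∈ univ.erase i, Λ i' (α i') ≠ 0 := by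
        by_contra! h0
        rw [Finset.sum_eq_zero h0] at hsum
        linarith
      refine ⟨i', α i', ne_of_mem_erase hi', ?_⟩
      rw [← Finset.add_sum_erase _ _ hi'] at hsum
      have hrest : ∑ x ∈ (univ.erase i).erase i', Λ x (α x) = 0 := by
        refine Finset.sum_eq_zero fun x hx => ?_
        have hle : Λ x (α x) ≤ ∑ x ∈ (univ.erase i).erase i', Λ x (α x) :=
          Finset.single_le_sum (f := fun x => Λ x (α x)) (fun y _ => hΛ.1.1 y _) hx
        rcases third x (α x) with h | h
        · exact h
        · have := (third i' (α i')).resolve_left hne'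
          linarith
      linarith
    have noThird : ∀ i j i' j', i' ≠ i → 1 / 3 < Λ i j → Λ i j < 2 / 3 → Λ i' j' ≠ 1 / 3 := by
      intro i j i' j' hii h1 h2 h3
      have := hE.partial_sum_le_or hd0 hn hΛ hδ0 hw {i, i'} (Function.update (fun _ => j) i' j')
      rw [Finset.sum_pair hii.symm, Function.update_self, Function.update_of_ne hii.symm] at this
      rcases this with h | h <;> linarith
    obtain ⟨i₁, j₁, hi₁, hj₁⟩ := partner i j hmid.1 (by linarith)
    have noThird' : ∀ a b, Λ a b ≠ 1 / 3 := by
      intro a b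
      by_cases ha : a = i
      · exact noThird i₁ j₁ a b (by rw [ha]; exact hi₁.symm) (by linarith) (by linarith)
      · exact noThird i j a b ha hmid.1 hmid.2
    obtain ⟨m, hm⟩ := half fun a b => by
      rcases entry_cases hδ0 a b with h | h | ⟨h, h'⟩
      · exact Or.inl h
      · exact Or.inr (Or.inl h)
      · have hlt := lt_of_le_of_ne h (noThird' a b).symm
        refine Or.inr (Or.inr ⟨hlt, lt_of_le_of_ne (by linarith) fun heq => ?_⟩)
        obtain ⟨a', b', -, hb'⟩ := partner a b hlt (by linarith)
        exact noThird' a' b' (by linarith)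
    have h3 : (0 : ℝ) < m := by linarith
    have h4 : (m : ℝ) < 1 := by linarith
    norm_cast at h3 h4
    omega
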